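/- The sequence g_0(n) converges to 2 as n → ∞. -/

import Mathlib

open Finset

/-- λ = 2 + √3 -/
noncomputable def lam : ℝ := 2 + Real.sqrt 3

/-- A_k = (λ^k + λ^{-k}) / 2 -/
noncomputable def A (k : ℕ) : ℝ := (lam ^ k + lam⁻¹ ^ k) / 2

/-- B_k = (λ^k - λ^{-k}) / (2√3) -/
noncomputable def B (k : ℕ) : ℝ := (lam ^ k - lam⁻¹ ^ k) / (2 * Real.sqrt 3)

/-- φ(t) = (1 + t²)/(1 + t)² -/
noncomputable def phi (t : ℝ) : ℝ := (1 + t ^ 2) / (1 + t) ^ 2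

/-- g_k(n) = (1/B_n)·(A_{n-k}·Σ_{j<k}(A_{j+1}+A_j)φ(A_{j+1}/A_j)
              + A_k·Σ_{j<n-k}(A_{j+1}+A_j)φ(A_{j+1}/A_j)) -/
noncomputable def g (k n : ℕ) : ℝ :=
  (1 / B n) *
    (A (n - k) * ∑ j ∈ Finset.range k, (A (j + 1) + A j) * phi (A (j + 1) / A j)
      + A k * ∑ j ∈ Finset.range (n - k), (A (j + 1) + A j) * phi (A (j + 1) / A j))

lemma lam_inv : lam⁻¹ = 2 - Real.sqrt 3 := by
  have h : Real.sqrt 3 ^ 2 = 3 := Real.sq_sqrt (by norm_num)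
  refine inv_eq_of_mul_eq_one_right ?_
  unfold lam
  linear_combination -h

lemma A_succ (j : ℕ) : A (j + 1) = 2 * A j + 3 * B j := by
  have h : Real.sqrt 3 ^ 2 = 3 := Real.sq_sqrt (by norm_num)
  have h0 : Real.sqrt 3 ≠ 0 := by positivity
  unfold A B
  rw [pow_succ, pow_succ, lam_inv]
  generalize (2 - Real.sqrt 3) ^ j = y
  unfold lam
  generalize (2 + Real.sqrt 3) ^ j = x
  field_simp
  linear_combination (x - y) * h

lemma B_succ (j : ℕ) : B (j + 1) = 2 * B j + A j := by
  have h0 : Real.sqrt 3 ≠ 0 := by positivity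
  unfold A B
  rw [pow_succ, pow_succ, lam_inv]
  generalize (2 - Real.sqrt 3) ^ j = y
  unfold lam
  generalize (2 + Real.sqrt 3) ^ j = x
  field_simp
  ring

lemma A_zero : A 0 = 1 := by simp [A]

lemma B_zero : B 0 = 0 := by simp [B]

/-- The Pell equation satisfied by `A` and `B`. -/
lemma A_sq_sub_three_mul_B_sq (j : ℕ) : A j ^ 2 - 3 * B j ^ 2 = 1 := by
  induction j with
  | zero => simp [A_zero, B_zero]
  | succ j ih =>
    rw [A_succ, B_succ]
    linear_combination ih

lemma two_pow_le_A_and_le_B (j : ℕ) : (2 : ℝ) ^ j ≤ A j ∧ (j : ℝ) ≤ B j := by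
  induction j with
  | zero => simp [A_zero, B_zero]
  | succ j ih =>
    obtain ⟨hA, hB⟩ := ih
    have h1 : (1 : ℝ) ≤ 2 ^ j := one_le_pow₀ (by norm_num)
    have h2 : (0 : ℝ) ≤ j := j.cast_nonneg
    rw [A_succ, B_succ, pow_succ]
    push_cast
    constructor <;> linarith

lemma add_mul_phi_div {a b : ℝ} (ha : 0 < a) (hb : 0 < b) :
    (a + b) * phi (a / b) = (a ^ 2 + b ^ 2) / (a + b) := by
  unfold phi
  have : b + a ≠ 0 := by positivity
  field_simp
  ring

lemma summand_eq (j : ℕ) : (A (j + 1) + A j) * phi (A (j + 1) / A j) =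
    2 * (B (j + 1) - B j) - 1 / (3 * (A j + B j)) := by
  obtain ⟨hA, hB⟩ := two_pow_le_A_and_le_B j
  have hA' : 0 < A j := lt_of_lt_of_le (by positivity) hA
  have hB' : 0 ≤ B j := le_trans j.cast_nonneg hB
  rw [add_mul_phi_div (by rw [A_succ]; positivity) hA', A_succ, B_succ]
  have h1 : 2 * A j + 3 * B j + A j = 3 * (A j + B j) := by ring
  have h2 : A j + B j ≠ 0 := by positivity
  rw [h1]
  field_simp
  linear_combination -A_sq_sub_three_mul_B_sq j

lemma sum_bounds (n : ℕ) :
    2 * B n - 1 + (1 / 2) ^ n ≤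
      ∑ j ∈ range n, (A (j + 1) + A j) * phi (A (j + 1) / A j) ∧
    ∑ j ∈ range n, (A (j + 1) + A j) * phi (A (j + 1) / A j) ≤ 2 * B n := by
  induction n with
  | zero => simp [B_zero]
  | succ n ih =>
    obtain ⟨hA, hB⟩ := two_pow_le_A_and_le_B n
    have hpow : (0 : ℝ) < 2 ^ n := by positivity
    have hB' : 0 ≤ B n := le_trans n.cast_nonneg hB
    have hpos : 0 < 1 / (3 * (A n + B n)) := by
      have : 0 < A n := hpow.trans_le hA
      positivity
    have hle : 1 / (3 * (A n + B n)) ≤ (1 / 2) ^ n / 2 := by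
      rw [one_div_pow, div_div]
      exact one_div_le_one_div_of_le (by positivity) (by linarith)
    rw [sum_range_succ, summand_eq, pow_succ]
    constructor <;> linarith [ih.1, ih.2]

theorem g_zero_tendsto_two :
    Filter.Tendsto (fun n : ℕ => g 0 n) Filter.atTop (nhds 2) := by
  have hlim : Filter.Tendsto (fun n : ℕ => (2 : ℝ) - 1 / n) Filter.atTop (nhds 2) := by
    simpa using tendsto_const_nhds.sub (tendsto_one_div_atTop_nhds_zero_nat (𝕜 := ℝ))
  have hg (n : ℕ) : g 0 n =
      (∑ j ∈ range n, (A (j + 1) + A j) * phi (A (j + 1) / A j)) / B n := by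
    simp [g, A_zero, div_eq_inv_mul]
  refine tendsto_of_tendsto_of_tendsto_of_le_of_le' hlim tendsto_const_nhds ?_ ?_
  all_goals
    filter_upwards [Filter.eventually_gt_atTop 0] with n hn
    have hn' : (0 : ℝ) < n := Nat.cast_pos.mpr hn
    have hB := (two_pow_le_A_and_le_B n).2
    have hBpos : 0 < B n := hn'.trans_le hB
    obtain ⟨hl, hu⟩ := sum_bounds n
    rw [hg]
  · rw [le_div_iff₀ hBpos]
    have h1 : 1 ≤ 1 / (n : ℝ) * B n := by
      rw [one_div_mul_eq_div]
      exact (one_le_div hn').mpr hB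
    have h2 : (0 : ℝ) < (1 / 2) ^ n := by positivity
    linarith
  · rwa [div_le_iff₀ hBpos]
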